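/- arXiv:2003.05575 — 2 statements merged into one kernel-verified Lean document; each statement's English description precedes it below -/
import Mathlib

section
/- Let m ≤ n be positive integers and let γ > 0 satisfy √(2γ) < 1/2 and α := 3γ + √(2γ) + h(√(2γ)) ≤ 1. Let A (taking values in F₂^{m×n}), x (taking values in F₂^n) and Y (taking finitely many values) be jointly distributed random variables on a finite probability space such that for every y in the support of Y, A and x are conditionally independent given Y = y. Let ε₁, ε₂ ≥ 0 and suppose there exist events E₁ and E₂ with Pr[E₁] ≥ 1 − ε₁ and Pr[E₂] ≥ 1 − ε₂ such that for every y in the support of Y: Pr[E₁ ∧ A = A₀ | Y = y] ≤ 2^{−(1−γ)·m·n} for every A₀ ∈ F₂^{m×n}, and Pr[E₂ ∧ x = x₀ | Y = y] ≤ 2^{−α·n} for every x₀ ∈ F₂^n. Then the smooth conditional min-entropy of the product Ax given Y satisfies H_∞^{ε}(Ax|Y) ≥ (1−√(2γ))·m with ε = ε₁ + ε₂ + 3m·2^{−γm}; concretely, there exist real numbers p(z, y) ∈ [0, 1], for z ∈ F₂^m and y in the support of Y, such that p(z, y) ≤ min( Pr[Ax = z | Y = y], 2^{−(1−√(2γ))·m}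 ) for all z, y, and Σ_y Pr[Y = y]·Σ_z p(z, y) ≥ 1 − ε. -/
open Finset

open Classical in
/-- Probability of an event under a weight function on a finite sample space. -/
noncomputable def prOf {Ω : Type*} [Fintype Ω] (w : Ω → ℝ) (E : Ω → Prop) : ℝ :=
  ∑ ω, if E ω then w ω else 0

/-- The binary entropy function with logarithms in base 2. -/
noncomputable def binEnt (p : ℝ) : ℝ :=
  -(p * Real.logb 2 p) - (1 - p) * Real.logb 2 (1 - p)


open Classical in
lemma aux_card {m n k : ℕ} (xs : Fin k → Fin n → ZMod 2) (h : LinearIndependent (ZMod 2) xs)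
    (S : Fin k → Finset (Fin m → ZMod 2)) :
    #{A : Matrix (Fin m) (Fin n) (ZMod 2) | ∀ j, A.mulVec (xs j) ∈ S j} * 2 ^ (m * k)
      = 2 ^ (m * n) * ∏ j, #(S j) := by
  let f : Matrix (Fin m) (Fin n) (ZMod 2) →+ (Fin k → Fin m → ZMod 2) :=
    { toFun := fun A j => A.mulVec (xs j)
      map_zero' := by ext; simp
      map_add' := by intro A B; ext; simp [Matrix.add_mulVec] }
  have hsurj : ∀ Z, Z ∈ Set.range f := by
    intro Z
    obtain ⟨g, hg⟩ : ∃ g : (Fin n → ZMod 2) →ₗ[ZMod 2] (Fin m → ZMod 2), ∀ j, g (xs j) = Z j := by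
      have hinj : LinearMap.ker (Fintype.linearCombination (ZMod 2) xs) = ⊥ :=
        LinearMap.ker_eq_bot.2 h.fintypeLinearCombination_injective
      obtain ⟨g, hg⟩ := LinearMap.exists_leftInverse_of_injective _ hinj
      refine ⟨(Fintype.linearCombination (ZMod 2) Z) ∘ₗ g, fun j => ?_⟩
      have := LinearMap.congr_fun hg (Pi.single j 1)
      simp [Fintype.linearCombination_apply_single] at this
      simp [this, Fintype.linearCombination_apply_single]
    refine ⟨LinearMap.toMatrix' g, ?_⟩
    ext1 j
    simp [f, hg]
  have hfib : ∀ Z, #{A | f A = Z} = #{A | f A = 0} := fun Z =>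
    AddMonoidHom.card_fiber_eq_of_mem_range f (hsurj Z) (hsurj 0)
  have h1 : #{A : Matrix (Fin m) (Fin n) (ZMod 2) | ∀ j, A.mulVec (xs j) ∈ S j}
      = (∏ j, #(S j)) * #{A | f A = 0} := by
    rw [card_eq_sum_card_fiberwise (f := f) (t := Fintype.piFinset S)]
    · rw [← Fintype.card_piFinset, ← smul_eq_mul, ← sum_const]
      refine sum_congr rfl fun Z hZ => ?_
      rw [← hfib Z, filter_filter]
      congr 1
      ext A
      simp only [mem_filter, mem_univ, true_and, and_iff_right_iff_imp]
      rintro rfl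
      simpa [f] using hZ
    · intro A hA
      simpa [f] using hA
  have h2 : 2 ^ (m * n) = 2 ^ (m * k) * #{A | f A = 0} := by
    have : Fintype.card (Matrix (Fin m) (Fin n) (ZMod 2)) = 2 ^ (m * n) := by
      have e := Fintype.card_congr (Matrix.of (m := Fin m) (n := Fin n) (α := ZMod 2))
      rw [← e]
      simp [ZMod.card, ← pow_mul, mul_comm]
    rw [← this, ← Finset.card_univ,
      card_eq_sum_card_fiberwise (f := f) (t := univ) (by intro A _; simp)]
    simp only [hfib, sum_const, smul_eq_mul, Finset.card_univ]
    simp [ZMod.card, ← pow_mul]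
  rw [h1, h2]; ring

open Classical in
lemma aux_tuple {n : ℕ} (ν : (Fin n → ZMod 2) → ℝ) (hν : ∀ x, 0 ≤ ν x) (c : ℝ)
    (hc : ∀ x, ν x ≤ c) (B : Finset (Fin n → ZMod 2)) (k : ℕ) (r : ℝ) (hr : 0 ≤ r)
    (hB : ∀ j < k, r ≤ ∑ x ∈ B, ν x - 2 ^ j * c) :
    ∀ j ≤ k, r ^ j ≤ ∑ xs : Fin j → Fin n → ZMod 2,
      if LinearIndependent (ZMod 2) xs ∧ ∀ i, xs i ∈ B then ∏ i, ν (xs i) else 0 := by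
  intro j
  induction j with
  | zero => intro _; simp
  | succ j ih =>
    intro hj
    have ih := ih (by omega)
    rw [← (Fin.consEquiv (fun _ => Fin n → ZMod 2)).sum_comp, Fintype.sum_prod_type_right, pow_succ]
    refine (mul_le_mul_of_nonneg_right ih hr).trans ?_
    rw [sum_mul]
    refine sum_le_sum fun v _ => ?_
    have hcons : ∀ x : Fin n → ZMod 2, LinearIndependent (ZMod 2)
        ((Fin.consEquiv (fun _ => Fin n → ZMod 2)) (x, v)) ↔ LinearIndependent (ZMod 2) v ∧
          x ∉ Submodule.span (ZMod 2) (Set.range v) := fun x => linearIndependent_finCons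
    simp only [hcons]
    simp only [Fin.consEquiv_apply, Fin.forall_fin_succ, Fin.cons_zero,
      Fin.cons_succ, Fin.prod_univ_succ]
    by_cases hv : LinearIndependent (ZMod 2) v ∧ ∀ i, v i ∈ B
    · rw [if_pos hv]
      have h1 : ∀ x, (if (LinearIndependent (ZMod 2) v ∧
          x ∉ Submodule.span (ZMod 2) (Set.range v)) ∧ x ∈ B ∧ ∀ i, v i ∈ B
          then ν x * ∏ i, ν (v i) else 0)
          = (∏ i, ν (v i)) * (if x ∈ B ∧ x ∉ Submodule.span (ZMod 2) (Set.range v)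
             then ν x else 0) := by
        intro x
        by_cases h1 : x ∈ B <;> by_cases h2 : x ∈ Submodule.span (ZMod 2) (Set.range v) <;>
          simp [h1, h2, hv.1, hv.2, mul_comm]
      simp only [h1]
      rw [← mul_sum]
      refine mul_le_mul_of_nonneg_left ?_ (prod_nonneg fun i _ => hν _)
      refine (hB j (by omega)).trans ?_
      have hspan : (#{x | x ∈ Submodule.span (ZMod 2) (Set.range v)} : ℝ) = 2 ^ j := by
        have : Fintype.card (Submodule.span (ZMod 2) (Set.range v)) = 2 ^ j := by
          rw [Module.card_eq_pow_finrank (K := ZMod 2), finrank_span_eq_card hv.1]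
          simp [ZMod.card]
        rw [← Fintype.card_subtype]
        exact_mod_cast this
      have h3 : ∑ x ∈ B, ν x ≤ (∑ x, if x ∈ B ∧ x ∉ Submodule.span (ZMod 2) (Set.range v)
             then ν x else 0) + ∑ x, if x ∈ Submodule.span (ZMod 2) (Set.range v) then c else 0 := by
        have hc0 : 0 ≤ c := (hν 0).trans (hc 0)
        rw [← sum_add_distrib, ← Finset.univ_inter B, ← Finset.sum_ite_mem]
        refine sum_le_sum fun x _ => ?_
        have := hc x
        by_cases h1 : x ∈ B <;> by_cases h2 : x ∈ Submodule.span (ZMod 2) (Set.range v) <;>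
          simp [h1, h2, this, hc0]
      have h4 : ∑ x, (if x ∈ Submodule.span (ZMod 2) (Set.range v) then c else 0) = 2 ^ j * c := by
        rw [← sum_filter, sum_const, nsmul_eq_mul, hspan]
      linarith
    · rw [if_neg hv, zero_mul]
      refine sum_nonneg fun x _ => ?_
      split_ifs
      · exact mul_nonneg (hν _) (prod_nonneg fun i _ => hν _)
      · exact le_rfl

open Classical in
lemma aux_core {m n : ℕ} (hn : 2 ≤ n) (hmn : m ≤ n) (γ δ b : ℝ) (hγ : 0 < γ)
    (hδ0 : 0 < δ) (hδ : δ < 1 / 2) (hδγ : δ * δ = 2 * γ) (hb : 0 ≤ b)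
    (μ : Matrix (Fin m) (Fin n) (ZMod 2) → ℝ) (ν : (Fin n → ZMod 2) → ℝ)
    (hμ : ∀ A, 0 ≤ μ A) (hν : ∀ x, 0 ≤ ν x) (hμ1 : ∑ A, μ A ≤ 1) (hν1 : ∑ x, ν x ≤ 1)
    (hμc : ∀ A, μ A ≤ (2 : ℝ) ^ (-((1 - γ) * (m : ℝ) * (n : ℝ))))
    (hνc : ∀ x, ν x ≤ (2 : ℝ) ^ (-((3 * γ + δ + b) * (n : ℝ))))
    (T : (Fin n → ZMod 2) → Finset (Fin m → ZMod 2))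
    (hT : ∀ x, (#(T x) : ℝ) ≤ (2 : ℝ) ^ ((1 - δ) * (m : ℝ))) :
    ∑ A : Matrix (Fin m) (Fin n) (ZMod 2), ∑ x, (if A.mulVec x ∈ T x then μ A * ν x else 0)
      ≤ 3 * (2 : ℝ) ^ (-(γ * (m : ℝ))) := by
  set q : ℝ := (2 : ℝ) ^ (-(γ * (m : ℝ))) with hq
  have hq0 : 0 < q := by positivity
  set k : ℕ := ⌈δ * n⌉₊ with hk
  have hkn : δ * n ≤ k := Nat.le_ceil _
  have hn' : (2 : ℝ) ≤ n := by exact_mod_cast hn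
  have hmn' : (m : ℝ) ≤ n := by exact_mod_cast hmn
  let B : Matrix (Fin m) (Fin n) (ZMod 2) → Finset (Fin n → ZMod 2) :=
    fun A => {x | A.mulVec x ∈ T x}
  let N : Matrix (Fin m) (Fin n) (ZMod 2) → ℝ := fun A => ∑ x ∈ B A, ν x
  have hN1 : ∀ A, N A ≤ 1 := fun A =>
    (sum_le_sum_of_subset_of_nonneg (subset_univ _) (fun x _ _ => hν x)).trans hν1
  -- mass of linearly independent tuples
  have htup : ∀ A, 2 * q < N A → q ^ k ≤ ∑ xs : Fin k → Fin n → ZMod 2,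
      if LinearIndependent (ZMod 2) xs ∧ ∀ i, xs i ∈ B A then ∏ i, ν (xs i) else 0 := by
    intro A hA
    refine aux_tuple ν hν _ hνc (B A) k q hq0.le ?_ k le_rfl
    intro j hj
    have hj' : (j : ℝ) < δ * n := Nat.lt_ceil.1 hj
    have : (2 : ℝ) ^ j * (2 : ℝ) ^ (-((3 * γ + δ + b) * (n : ℝ))) ≤ q := by
      rw [← Real.rpow_natCast, ← Real.rpow_add (by norm_num), hq]
      apply Real.rpow_le_rpow_of_exponent_le (by norm_num)
      nlinarith [mul_nonneg hb (by linarith : (0:ℝ) ≤ n), mul_le_mul_of_nonneg_left hmn' hγ.le,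
        mul_nonneg hγ.le (by linarith : (0:ℝ) ≤ n)]
    have hA' : 2 * q < ∑ x ∈ B A, ν x := hA
    linarith
  -- mass of matrices for a fixed tuple
  have hmat : ∀ xs : Fin k → Fin n → ZMod 2, LinearIndependent (ZMod 2) xs →
      ∑ A, (if ∀ i, xs i ∈ B A then μ A else 0) ≤ q ^ (k + 1) := by
    intro xs hxs
    have hcard := aux_card (m := m) xs hxs (fun j => T (xs j))
    set C := #{A : Matrix (Fin m) (Fin n) (ZMod 2) | ∀ j, A.mulVec (xs j) ∈ T (xs j)} with hC
    have hcard' : (C : ℝ) * 2 ^ (m * k) = 2 ^ (m * n) * ∏ j, (#(T (xs j)) : ℝ) := by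
      exact_mod_cast hcard
    have hprod : ∏ j, (#(T (xs j)) : ℝ) ≤ ((2 : ℝ) ^ ((1 - δ) * (m : ℝ))) ^ k := by
      refine (prod_le_prod (fun _ _ => by positivity) (fun j _ => hT (xs j))).trans ?_
      simp
    have h1 : ∑ A, (if ∀ i, xs i ∈ B A then μ A else 0)
        ≤ C * (2 : ℝ) ^ (-((1 - γ) * (m : ℝ) * (n : ℝ))) := by
      simp only [B, mem_filter, mem_univ, true_and]
      rw [← sum_filter, ← nsmul_eq_mul, hC]
      exact sum_le_card_nsmul _ _ _ fun A _ => hμc A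
    refine h1.trans ?_
    have hp : (0 : ℝ) < 2 ^ (m * k) := by positivity
    rw [← mul_le_mul_iff_left₀ hp]
    calc (C : ℝ) * (2 : ℝ) ^ (-((1 - γ) * (m : ℝ) * (n : ℝ))) * 2 ^ (m * k)
        = 2 ^ (m * n) * (∏ j, (#(T (xs j)) : ℝ)) * (2 : ℝ) ^ (-((1 - γ) * (m : ℝ) * (n : ℝ))) := by
          rw [← hcard']; ring
      _ ≤ 2 ^ (m * n) * ((2 : ℝ) ^ ((1 - δ) * (m : ℝ))) ^ k
            * (2 : ℝ) ^ (-((1 - γ) * (m : ℝ) * (n : ℝ))) := by gcongr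
      _ ≤ q ^ (k + 1) * 2 ^ (m * k) := by
          rw [hq]
          simp only [← Real.rpow_natCast, ← Real.rpow_mul (by norm_num : (0:ℝ) ≤ 2),
            ← Real.rpow_add (by norm_num : (0:ℝ) < 2)]
          apply Real.rpow_le_rpow_of_exponent_le (by norm_num)
          push_cast
          have hm0 : (0 : ℝ) ≤ m := by positivity
          have key : γ * n - δ * k + γ * k + γ ≤ 0 := by
            have h2 : (δ - γ) * (δ * n) ≤ (δ - γ) * k :=
              mul_le_mul_of_nonneg_left hkn (by nlinarith)
            have h3 : γ * (1 - n * (1 - δ)) ≤ 0 :=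
              mul_nonpos_of_nonneg_of_nonpos hγ.le (by nlinarith)
            have h4 : (δ - γ) * (δ * n) = 2 * γ * n - γ * δ * n := by
              rw [← hδγ]; ring
            nlinarith
          nlinarith [mul_nonpos_of_nonneg_of_nonpos hm0 key]
  -- bad matrices
  have hbad : ∑ A, (if 2 * q < N A then μ A else 0) ≤ q := by
    have hqk : 0 < q ^ k := by positivity
    rw [← mul_le_mul_iff_left₀ hqk]
    calc (∑ A, (if 2 * q < N A then μ A else 0)) * q ^ k
        ≤ ∑ A, μ A * ∑ xs : Fin k → Fin n → ZMod 2,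
          (if LinearIndependent (ZMod 2) xs ∧ ∀ i, xs i ∈ B A then ∏ i, ν (xs i) else 0) := by
          rw [sum_mul]
          refine sum_le_sum fun A _ => ?_
          split_ifs with h
          · exact mul_le_mul_of_nonneg_left (htup A h) (hμ A)
          · rw [zero_mul]
            refine mul_nonneg (hμ A) (sum_nonneg fun xs _ => ?_)
            split_ifs
            · exact prod_nonneg fun i _ => hν _
            · exact le_rfl
      _ = ∑ xs : Fin k → Fin n → ZMod 2, if LinearIndependent (ZMod 2) xs then
            (∏ i, ν (xs i)) * ∑ A, (if ∀ i, xs i ∈ B A then μ A else 0) else 0 := by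
          simp only [mul_sum]
          rw [sum_comm]
          refine sum_congr rfl fun xs _ => ?_
          by_cases h : LinearIndependent (ZMod 2) xs
          · simp only [h, true_and, if_true]
            refine sum_congr rfl fun A _ => ?_
            split_ifs <;> ring
          · simp [h]
      _ ≤ ∑ xs : Fin k → Fin n → ZMod 2, (∏ i, ν (xs i)) * q ^ (k + 1) := by
          refine sum_le_sum fun xs _ => ?_
          have h0 : 0 ≤ ∏ i, ν (xs i) := prod_nonneg fun i _ => hν _
          split_ifs with h
          · exact mul_le_mul_of_nonneg_left (hmat xs h) h0
          · positivity
      _ = (∑ x, ν x) ^ k * q ^ (k + 1) := by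
          rw [← sum_mul, Fintype.sum_pow]
      _ ≤ 1 * q ^ (k + 1) := by
          gcongr
          exact pow_le_one₀ (sum_nonneg fun x _ => hν x) hν1
      _ = q * q ^ k := by ring
  calc ∑ A : Matrix (Fin m) (Fin n) (ZMod 2), ∑ x, (if A.mulVec x ∈ T x then μ A * ν x else 0)
      = ∑ A, μ A * N A := by
        refine sum_congr rfl fun A _ => ?_
        simp only [N, B, mul_sum, sum_filter, mul_ite, mul_zero]
    _ ≤ ∑ A, (μ A * (2 * q) + if 2 * q < N A then μ A else 0) := by
        refine sum_le_sum fun A _ => ?_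
        have := hμ A
        split_ifs with h
        · nlinarith [hN1 A, mul_nonneg this hq0.le, mul_le_mul_of_nonneg_left (hN1 A) this]
        · rw [add_zero]; exact mul_le_mul_of_nonneg_left (not_lt.1 h) this
    _ ≤ 1 * (2 * q) + q := by
        rw [sum_add_distrib, ← sum_mul]
        gcongr
    _ = 3 * q := by ring

lemma aux_binEnt {δ : ℝ} (h0 : 0 < δ) (h1 : δ < 1 / 2) : 0 ≤ binEnt δ := by
  unfold binEnt
  have := Real.logb_nonpos (b := 2) (by norm_num) h0.le (by linarith)
  have := Real.logb_nonpos (b := 2) (x := 1 - δ) (by norm_num) (by linarith) (by linarith)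
  nlinarith

/-- pointwise version -/
lemma aux_point {m n : ℕ} (hn : 2 ≤ n) (hmn : m ≤ n) (γ δ b : ℝ) (hγ : 0 < γ)
    (hδ0 : 0 < δ) (hδ : δ < 1 / 2) (hδγ : δ * δ = 2 * γ) (hb : 0 ≤ b)
    (μ : Matrix (Fin m) (Fin n) (ZMod 2) → ℝ) (ν : (Fin n → ZMod 2) → ℝ)
    (hμ : ∀ A, 0 ≤ μ A) (hν : ∀ x, 0 ≤ ν x) (hμ1 : ∑ A, μ A ≤ 1) (hν1 : ∑ x, ν x ≤ 1)
    (hμc : ∀ A, μ A ≤ (2 : ℝ) ^ (-((1 - γ) * (m : ℝ) * (n : ℝ))))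
    (hνc : ∀ x, ν x ≤ (2 : ℝ) ^ (-((3 * γ + δ + b) * (n : ℝ)))) :
    ∃ p : (Fin m → ZMod 2) → ℝ,
      (∀ z, 0 ≤ p z) ∧
      (∀ z, p z ≤ ∑ A : Matrix (Fin m) (Fin n) (ZMod 2), ∑ x,
        if A.mulVec x = z then μ A * ν x else 0) ∧
      (∀ z, p z ≤ (2 : ℝ) ^ (-((1 - δ) * (m : ℝ)))) ∧
      (∑ A, μ A) + (∑ x, ν x) - 1 - 3 * (2 : ℝ) ^ (-(γ * (m : ℝ))) ≤ ∑ z, p z := by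
  classical
  set L : ℝ := (2 : ℝ) ^ (-((1 - δ) * (m : ℝ))) with hL
  have hL0 : 0 < L := by positivity
  let Q : (Fin n → ZMod 2) → (Fin m → ZMod 2) → ℝ :=
    fun x z => ∑ A : Matrix (Fin m) (Fin n) (ZMod 2), if A.mulVec x = z then μ A else 0
  have hQ0 : ∀ x z, 0 ≤ Q x z := fun x z => sum_nonneg fun A _ => by
    have := hμ A; split_ifs <;> simp [this]
  have hQs : ∀ x, ∑ z, Q x z = ∑ A, μ A := fun x => by
    simp only [Q]; rw [sum_comm]; simp
  let T : (Fin n → ZMod 2) → Finset (Fin m → ZMod 2) := fun x => {z | L < Q x z}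
  have hT : ∀ x, (#(T x) : ℝ) ≤ (2 : ℝ) ^ ((1 - δ) * (m : ℝ)) := by
    intro x
    have h1 : (#(T x) : ℝ) * L ≤ 1 := by
      rw [← nsmul_eq_mul]
      refine (card_nsmul_le_sum (T x) (Q x) L ?_).trans ?_
      · intro z hz
        simp only [T, mem_filter] at hz
        exact hz.2.le
      · exact (sum_le_sum_of_subset_of_nonneg (subset_univ _) (fun z _ _ => hQ0 x z)).trans
          ((hQs x).le.trans hμ1)
    rw [hL, Real.rpow_neg (by norm_num), ← div_eq_mul_inv, div_le_one (by positivity)] at h1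
    exact h1
  have hcore := aux_core hn hmn γ δ b hγ hδ0 hδ hδγ hb μ ν hμ hν hμ1 hν1 hμc hνc T hT
  have hnn : ∀ (A : Matrix (Fin m) (Fin n) (ZMod 2)) x, 0 ≤ μ A * ν x :=
    fun A x => mul_nonneg (hμ A) (hν x)
  refine ⟨fun z => ∑ A : Matrix (Fin m) (Fin n) (ZMod 2), ∑ x,
    if A.mulVec x = z ∧ z ∉ T x then μ A * ν x else 0, ?_, ?_, ?_, ?_⟩
  · intro z
    refine sum_nonneg fun A _ => sum_nonneg fun x _ => ?_
    split_ifs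
    · exact hnn A x
    · exact le_rfl
  · intro z
    refine sum_le_sum fun A _ => sum_le_sum fun x _ => ?_
    have := hnn A x
    by_cases h1 : A.mulVec x = z <;> by_cases h2 : z ∈ T x <;> simp [h1, h2, this]
  · intro z
    dsimp only
    rw [sum_comm]
    calc _ ≤ ∑ x, ν x * L := by
          refine sum_le_sum fun x _ => ?_
          by_cases h2 : z ∈ T x
          · simp only [h2, not_true_eq_false, and_false, if_false, sum_const_zero]
            exact mul_nonneg (hν x) hL0.le
          · have h3 : Q x z ≤ L := by simpa [T] using h2
            refine le_trans (le_of_eq ?_) (mul_le_mul_of_nonneg_left h3 (hν x))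
            simp only [Q, mul_sum, h2, not_false_eq_true, and_true]
            refine sum_congr rfl fun A _ => ?_
            split_ifs <;> ring
      _ ≤ L := by
          rw [← sum_mul]
          nlinarith
  · have h1 : (∑ A, μ A) * (∑ x, ν x) = (∑ z, ∑ A : Matrix (Fin m) (Fin n) (ZMod 2), ∑ x,
          if A.mulVec x = z ∧ z ∉ T x then μ A * ν x else 0) +
        ∑ A : Matrix (Fin m) (Fin n) (ZMod 2), ∑ x,
          (if A.mulVec x ∈ T x then μ A * ν x else 0) := by
      rw [sum_comm, ← sum_add_distrib, sum_mul]
      refine sum_congr rfl fun A _ => ?_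
      rw [sum_comm, ← sum_add_distrib, mul_sum]
      refine sum_congr rfl fun x _ => ?_
      simp only [ite_and, sum_ite_eq, mem_univ, if_true]
      by_cases h : A.mulVec x ∈ T x <;> simp [h]
    have h2 : 0 ≤ (1 - ∑ A, μ A) * (1 - ∑ x, ν x) :=
      mul_nonneg (by linarith) (by linarith)
    dsimp only
    linarith

lemma prOf_nonneg' {Ω : Type*} [Fintype Ω] {w : Ω → ℝ} (hw : ∀ ω, 0 ≤ w ω) (E : Ω → Prop) :
    0 ≤ prOf w E := by
  classical
  unfold prOf
  refine sum_nonneg fun ω _ => ?_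
  split_ifs
  · exact hw ω
  · exact le_rfl

lemma prOf_mono' {Ω : Type*} [Fintype Ω] {w : Ω → ℝ} (hw : ∀ ω, 0 ≤ w ω) {E F : Ω → Prop}
    (h : ∀ ω, E ω → F ω) : prOf w E ≤ prOf w F := by
  classical
  unfold prOf
  refine sum_le_sum fun ω _ => ?_
  have := hw ω
  by_cases h1 : E ω
  · simp [h1, h ω h1]
  · by_cases h2 : F ω <;> simp [h1, h2, this]

lemma prOf_sum' {Ω α : Type*} [Fintype Ω] [Fintype α] (w : Ω → ℝ) (f : Ω → α)
    (E : Ω → Prop) : ∑ a, prOf w (fun ω => E ω ∧ f ω = a) = prOf w E := by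
  classical
  unfold prOf
  rw [sum_comm]
  refine sum_congr rfl fun ω _ => ?_
  by_cases h : E ω <;> simp [h]

lemma prOf_sum3 {Ω α β : Type*} [Fintype Ω] [Fintype α] (w : Ω → ℝ) (f : Ω → α)
    (E : Ω → Prop) (Y : Ω → β) (y : β) :
    ∑ a, prOf w (fun ω => E ω ∧ f ω = a ∧ Y ω = y) = prOf w (fun ω => E ω ∧ Y ω = y) := by
  rw [← prOf_sum' w f]
  refine sum_congr rfl fun a _ => ?_
  congr 1; ext ω; tauto

/-- Min-entropy theorem for matrix-vector multiplication over `F₂`: if, given `Y`, the matrix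
`A` and the vector `x` are conditionally independent with smooth conditional min-entropies at
least `(1-γ)·m·n` and `α·n` respectively (witnessed by events `E₁`, `E₂`), then the product
`A·x` given `Y` has smooth conditional min-entropy at least `(1-√(2γ))·m`, with smoothness
parameter `ε = ε₁ + ε₂ + 3m·2^{-γm}`, witnessed by a subdistribution `p`. -/
theorem min_entropy_matrix_vector_mul
    {Ω β : Type*} [Fintype Ω] [Fintype β]
    (m n : ℕ) (hm : 1 ≤ m) (hmn : m ≤ n)
    (γ : ℝ) (hγ : 0 < γ) (hγhalf : Real.sqrt (2 * γ) < 1 / 2)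
    (hα1 : 3 * γ + Real.sqrt (2 * γ) + binEnt (Real.sqrt (2 * γ)) ≤ 1)
    (w : Ω → ℝ) (hw : ∀ ω, 0 ≤ w ω) (hw1 : ∑ ω, w ω = 1)
    (A : Ω → Matrix (Fin m) (Fin n) (ZMod 2)) (x : Ω → (Fin n → ZMod 2)) (Y : Ω → β)
    (hindep : ∀ y : β, 0 < prOf w (fun ω => Y ω = y) →
      ∀ (A₀ : Matrix (Fin m) (Fin n) (ZMod 2)) (x₀ : Fin n → ZMod 2),
        prOf w (fun ω => A ω = A₀ ∧ x ω = x₀ ∧ Y ω = y) / prOf w (fun ω => Y ω = y)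
          = (prOf w (fun ω => A ω = A₀ ∧ Y ω = y) / prOf w (fun ω => Y ω = y))
            * (prOf w (fun ω => x ω = x₀ ∧ Y ω = y) / prOf w (fun ω => Y ω = y)))
    (ε₁ ε₂ : ℝ) (hε₁ : 0 ≤ ε₁) (hε₂ : 0 ≤ ε₂)
    (E₁ E₂ : Ω → Prop)
    (hE₁ : 1 - ε₁ ≤ prOf w E₁) (hE₂ : 1 - ε₂ ≤ prOf w E₂)
    (hAent : ∀ y : β, 0 < prOf w (fun ω => Y ω = y) →
      ∀ A₀ : Matrix (Fin m) (Fin n) (ZMod 2),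
        prOf w (fun ω => E₁ ω ∧ A ω = A₀ ∧ Y ω = y) / prOf w (fun ω => Y ω = y)
          ≤ (2 : ℝ) ^ (-((1 - γ) * (m : ℝ) * (n : ℝ))))
    (hxent : ∀ y : β, 0 < prOf w (fun ω => Y ω = y) →
      ∀ x₀ : Fin n → ZMod 2,
        prOf w (fun ω => E₂ ω ∧ x ω = x₀ ∧ Y ω = y) / prOf w (fun ω => Y ω = y)
          ≤ (2 : ℝ) ^ (-((3 * γ + Real.sqrt (2 * γ) + binEnt (Real.sqrt (2 * γ))) * (n : ℝ)))) :
    ∃ p : (Fin m → ZMod 2) → β → ℝ,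
      (∀ z y, 0 ≤ p z y ∧ p z y ≤ 1) ∧
      (∀ (z : Fin m → ZMod 2) (y : β), 0 < prOf w (fun ω => Y ω = y) →
        p z y ≤ prOf w (fun ω => (A ω).mulVec (x ω) = z ∧ Y ω = y)
                  / prOf w (fun ω => Y ω = y) ∧
        p z y ≤ (2 : ℝ) ^ (-((1 - Real.sqrt (2 * γ)) * (m : ℝ)))) ∧
      1 - (ε₁ + ε₂ + 3 * (m : ℝ) * (2 : ℝ) ^ (-(γ * (m : ℝ))))
        ≤ ∑ y, prOf w (fun ω => Y ω = y) * ∑ z, p z y := by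
  classical
  set δ := Real.sqrt (2 * γ) with hδ
  have hδ0 : 0 < δ := Real.sqrt_pos.2 (by linarith)
  have hδγ : δ * δ = 2 * γ := Real.mul_self_sqrt (by linarith)
  set q : ℝ := (2 : ℝ) ^ (-(γ * (m : ℝ))) with hq
  have hq0 : 0 < q := by positivity
  have hm' : (1 : ℝ) ≤ m := by exact_mod_cast hm
  rcases Nat.lt_or_ge n 2 with hn | hn
  · refine ⟨fun _ _ => 0, by simp, fun z y hy => ⟨div_nonneg (prOf_nonneg' hw _) hy.le,
      by positivity⟩, ?_⟩
    have hm1 : m = 1 := by omega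
    have h1 : (2 : ℝ) ^ (-1 : ℝ) ≤ q := by
      rw [hq, hm1]
      apply Real.rpow_le_rpow_of_exponent_le (by norm_num)
      push_cast
      nlinarith
    rw [Real.rpow_neg_one] at h1
    simp only [sum_const_zero, mul_zero]
    rw [hm1]
    push_cast
    linarith
  have hb := aux_binEnt hδ0 hγhalf
  have main : ∀ y : β, ∃ p : (Fin m → ZMod 2) → ℝ,
      (∀ z, 0 ≤ p z ∧ p z ≤ 1) ∧
      (∀ z, 0 < prOf w (fun ω => Y ω = y) →
        p z ≤ prOf w (fun ω => (A ω).mulVec (x ω) = z ∧ Y ω = y)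
                  / prOf w (fun ω => Y ω = y) ∧
        p z ≤ (2 : ℝ) ^ (-((1 - δ) * (m : ℝ)))) ∧
      prOf w (fun ω => E₁ ω ∧ Y ω = y) + prOf w (fun ω => E₂ ω ∧ Y ω = y)
        - prOf w (fun ω => Y ω = y) - 3 * q * prOf w (fun ω => Y ω = y)
        ≤ prOf w (fun ω => Y ω = y) * ∑ z, p z := by
    intro y
    set P := prOf w (fun ω => Y ω = y) with hP
    have hE1P : prOf w (fun ω => E₁ ω ∧ Y ω = y) ≤ P := prOf_mono' hw fun ω h => h.2
    have hE2P : prOf w (fun ω => E₂ ω ∧ Y ω = y) ≤ P := prOf_mono' hw fun ω h => h.2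
    have hP0 : 0 ≤ P := prOf_nonneg' hw _
    rcases hP0.eq_or_lt with h0 | hpos
    · refine ⟨fun _ => 0, by simp, fun z hy => absurd hy (by simp [← h0]), ?_⟩
      rw [← h0] at hE1P hE2P ⊢
      simp only [sum_const_zero, mul_zero]
      linarith
    · have hsμ : ∑ A₀, prOf w (fun ω => E₁ ω ∧ A ω = A₀ ∧ Y ω = y) / P
          = prOf w (fun ω => E₁ ω ∧ Y ω = y) / P := by
        rw [← sum_div, prOf_sum3]
      have hsν : ∑ x₀, prOf w (fun ω => E₂ ω ∧ x ω = x₀ ∧ Y ω = y) / P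
          = prOf w (fun ω => E₂ ω ∧ Y ω = y) / P := by
        rw [← sum_div, prOf_sum3]
      obtain ⟨p, hp0, hp1, hp2, hp3⟩ := aux_point hn hmn γ δ (binEnt δ) hγ hδ0 hγhalf hδγ hb
        (fun A₀ => prOf w (fun ω => E₁ ω ∧ A ω = A₀ ∧ Y ω = y) / P)
        (fun x₀ => prOf w (fun ω => E₂ ω ∧ x ω = x₀ ∧ Y ω = y) / P)
        (fun A₀ => div_nonneg (prOf_nonneg' hw _) hP0)
        (fun x₀ => div_nonneg (prOf_nonneg' hw _) hP0)
        (by rw [hsμ]; exact div_le_one_of_le₀ hE1P hP0)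
        (by rw [hsν]; exact div_le_one_of_le₀ hE2P hP0)
        (hAent y hpos) (hxent y hpos)
      refine ⟨p, fun z => ⟨hp0 z, (hp2 z).trans ?_⟩, fun z _ => ⟨(hp1 z).trans ?_, hp2 z⟩, ?_⟩
      · apply Real.rpow_le_one_of_one_le_of_nonpos (by norm_num)
        nlinarith
      · have hle : ∀ (A₀ : Matrix (Fin m) (Fin n) (ZMod 2)) (x₀ : Fin n → ZMod 2),
            prOf w (fun ω => E₁ ω ∧ A ω = A₀ ∧ Y ω = y) / P *
              (prOf w (fun ω => E₂ ω ∧ x ω = x₀ ∧ Y ω = y) / P)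
            ≤ prOf w (fun ω => A ω = A₀ ∧ x ω = x₀ ∧ Y ω = y) / P := by
          intro A₀ x₀
          rw [hindep y hpos]
          apply mul_le_mul
          · exact div_le_div_of_nonneg_right (prOf_mono' hw fun ω h => h.2) hP0
          · exact div_le_div_of_nonneg_right (prOf_mono' hw fun ω h => h.2) hP0
          · exact div_nonneg (prOf_nonneg' hw _) hP0
          · exact div_nonneg (prOf_nonneg' hw _) hP0
        have heq : prOf w (fun ω => (A ω).mulVec (x ω) = z ∧ Y ω = y)
            = ∑ A₀ : Matrix (Fin m) (Fin n) (ZMod 2), ∑ x₀ : Fin n → ZMod 2,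
              if A₀.mulVec x₀ = z then prOf w (fun ω => A ω = A₀ ∧ x ω = x₀ ∧ Y ω = y) else 0 := by
          rw [← prOf_sum' w A]
          refine sum_congr rfl fun A₀ _ => ?_
          rw [← prOf_sum' w x]
          refine sum_congr rfl fun x₀ _ => ?_
          split_ifs with h
          · congr 1
            ext ω
            constructor
            · rintro ⟨⟨⟨_, h1⟩, h2⟩, h3⟩
              exact ⟨h2, h3, h1⟩
            · rintro ⟨h2, h3, h1⟩
              exact ⟨⟨⟨by rw [h2, h3, h], h1⟩, h2⟩, h3⟩
          · unfold prOf
            refine sum_eq_zero fun ω _ => if_neg ?_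
            rintro ⟨⟨⟨h0, h1⟩, h2⟩, h3⟩
            rw [h2, h3] at h0
            exact h h0
        rw [heq, sum_div]
        refine sum_le_sum fun A₀ _ => ?_
        rw [sum_div]
        refine sum_le_sum fun x₀ _ => ?_
        split_ifs
        · exact hle A₀ x₀
        · simp
      · rw [hsμ, hsν] at hp3
        have := mul_le_mul_of_nonneg_left hp3 hP0
        refine le_trans (le_of_eq ?_) this
        rw [← hq]
        field_simp
  choose p hp1 hp2 hp3 using main
  refine ⟨fun z y => p y z, fun z y => hp1 y z, fun z y hy => hp2 y z hy, ?_⟩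
  have hsum := sum_le_sum fun y (_ : y ∈ (univ : Finset β)) => hp3 y
  have hY : ∑ y, prOf w (fun ω => Y ω = y) = 1 := by
    have h := prOf_sum' w Y (fun _ => True)
    simp only [true_and] at h
    rw [h]
    simp [prOf, hw1]
  rw [sum_sub_distrib, sum_sub_distrib, sum_add_distrib, prOf_sum', prOf_sum', ← mul_sum, hY]
    at hsum
  refine le_trans ?_ hsum
  nlinarith
end

section
/- Let m, n ≥ 1, let γ, τ, Δ > 0, δ ∈ (0, 1], and set η := √(τ+γ), assuming η ≤ 1. Let x (distributed over F₂^n) and A (distributed over F₂^{m×n}) be independent random variables with H_∞(x) ≥ (2Δ + η)·n + log₂(1/δ) and H_∞(A) ≥ (1−γ)·m·n. Let B be any bad-set assignment for A and set ε_bad := Pr[A is (τ,δ)-bad with respect to B]. Then the distribution of the matrix-vector product Ax over F₂ is (ε_bad + m·2^{−Δ·n})-close to a distribution on F₂^m with min-entropy at least (1−η)·m. -/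
open Finset

open Classical in
/-- Probability of an event for a random matrix over `F₂` with mass function `μ`. -/
noncomputable def prEvt {m n : ℕ} (μ : Matrix (Fin m) (Fin n) (ZMod 2) → ℝ)
    (E : Matrix (Fin m) (Fin n) (ZMod 2) → Prop) : ℝ :=
  ∑ A, if E A then μ A else 0

/-- `rowsAgree i A B` says that the first `i` rows of `A` and `B` coincide. -/
def rowsAgree {m n : ℕ} (i : ℕ) (A B : Matrix (Fin m) (Fin n) (ZMod 2)) : Prop :=
  ∀ j : Fin m, (j : ℕ) < i → A j = B j

/-- `pIdx μ i A₀` is the conditional probability that row `i` of a `μ`-random matrix equals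
row `i` of `A₀`, given that the previous rows agree with those of `A₀`. -/
noncomputable def pIdx {m n : ℕ} (μ : Matrix (Fin m) (Fin n) (ZMod 2) → ℝ)
    (i : Fin m) (A₀ : Matrix (Fin m) (Fin n) (ZMod 2)) : ℝ :=
  prEvt μ (fun B => B i = A₀ i ∧ rowsAgree (i : ℕ) B A₀)
    / prEvt μ (fun B => rowsAgree (i : ℕ) B A₀)

/-- `qIdx μ i A₀ = -log₂ (pIdx μ i A₀)`. -/
noncomputable def qIdx {m n : ℕ} (μ : Matrix (Fin m) (Fin n) (ZMod 2) → ℝ)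
    (i : Fin m) (A₀ : Matrix (Fin m) (Fin n) (ZMod 2)) : ℝ :=
  -Real.logb 2 (pIdx μ i A₀)

/-- `A₀` is `τ`-rare if some conditional row probability is below `2 ^ (-n (1 + τ))`. -/
def tauRare {m n : ℕ} (μ : Matrix (Fin m) (Fin n) (ZMod 2) → ℝ) (τ : ℝ)
    (A₀ : Matrix (Fin m) (Fin n) (ZMod 2)) : Prop :=
  ∃ i : Fin m, pIdx μ i A₀ < (2 : ℝ) ^ (-((n : ℝ) * (1 + τ)))

/-- A bad-set assignment for the random matrix distributed according to `μ`: every `τ`-rare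
matrix in the support is mapped to `⊥` (here `none`) and every non-`τ`-rare matrix in the
support is mapped to a set of at most `√(τ+γ)·m` rows outside of which the conditional
surprise `qᵢ` is at least `(1 - √(τ+γ))·n`. -/
def IsBadSetAssignment {m n : ℕ} (μ : Matrix (Fin m) (Fin n) (ZMod 2) → ℝ) (τ γ : ℝ)
    (B : Matrix (Fin m) (Fin n) (ZMod 2) → Option (Finset (Fin m))) : Prop :=
  ∀ A₀, 0 < μ A₀ →
    (tauRare μ τ A₀ → B A₀ = none) ∧
    (¬ tauRare μ τ A₀ → ∃ S : Finset (Fin m), B A₀ = some S ∧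
      (S.card : ℝ) ≤ Real.sqrt (τ + γ) * (m : ℝ) ∧
      ∀ i : Fin m, i ∉ S → (1 - Real.sqrt (τ + γ)) * (n : ℝ) ≤ qIdx μ i A₀)

/-- `A₀` is `(τ,δ)`-bad with respect to the bad-set assignment `B`: either `A₀` is `τ`-rare,
or for some `i` the conditional probability that `B` of the random matrix equals `B A₀`, given
that the first `i` rows agree with `A₀`, is below `δ`. -/
def IsTauDeltaBad {m n : ℕ} (μ : Matrix (Fin m) (Fin n) (ZMod 2) → ℝ) (τ δ : ℝ)
    (B : Matrix (Fin m) (Fin n) (ZMod 2) → Option (Finset (Fin m)))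
    (A₀ : Matrix (Fin m) (Fin n) (ZMod 2)) : Prop :=
  tauRare μ τ A₀ ∨ ∃ i : Fin m,
    prEvt μ (fun C => B C = B A₀ ∧ rowsAgree (i : ℕ) C A₀)
      / prEvt μ (fun C => rowsAgree (i : ℕ) C A₀) < δ

open Classical in
/-- The distribution of the matrix-vector product `A·x` over `F₂`, where `A ~ μA` and `x ~ μx`
are independent. -/
noncomputable def prodDist {m n : ℕ} (μA : Matrix (Fin m) (Fin n) (ZMod 2) → ℝ)
    (μx : (Fin n → ZMod 2) → ℝ) (z : Fin m → ZMod 2) : ℝ :=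
  ∑ A, ∑ x₀, if A.mulVec x₀ = z then μA A * μx x₀ else 0

lemma close_of_excess {Z : Type*} [Fintype Z] (P : Z → ℝ) (K ε : ℝ)
    (hP0 : ∀ z, 0 ≤ P z) (hP1 : ∑ z, P z = 1) (hK0 : 0 ≤ K) (hK : 1 ≤ (Fintype.card Z : ℝ) * K)
    (hε : ∑ z, max (P z - K) 0 ≤ ε) :
    ∃ ν : Z → ℝ, (∀ z, 0 ≤ ν z) ∧ (∑ z, ν z = 1) ∧ (∀ z, ν z ≤ K) ∧
      (1 / 2) * ∑ z, |P z - ν z| ≤ ε := by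
  set e := ∑ z, max (P z - K) 0 with he
  set t := ∑ z, max (K - P z) 0 with ht
  have he0 : 0 ≤ e := Finset.sum_nonneg fun z _ => le_max_right _ _
  have ht0 : 0 ≤ t := Finset.sum_nonneg fun z _ => le_max_right _ _
  have hte : t - e = Fintype.card Z * K - 1 := by
    rw [ht, he, ← Finset.sum_sub_distrib, ← hP1]
    have : (Fintype.card Z : ℝ) * K = ∑ z : Z, K := by simp
    rw [this, ← Finset.sum_sub_distrib]
    refine Finset.sum_congr rfl fun z _ => ?_
    rcases le_total (P z) K with h | h
    · rw [max_eq_left (by linarith), max_eq_right (by linarith)]; ring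
    · rw [max_eq_right (by linarith), max_eq_left (by linarith)]; ring
  have het : e ≤ t := by linarith
  set q := e / t with hq
  have hq0 : 0 ≤ q := div_nonneg he0 ht0
  have hq1 : q ≤ 1 := div_le_one_of_le₀ het ht0
  have hqt : q * t = e := by
    rcases eq_or_lt_of_le ht0 with h | h
    · rw [← h]; rw [← h] at het; linarith
    · rw [hq]; field_simp
  refine ⟨fun z => P z - max (P z - K) 0 + q * max (K - P z) 0, ?_, ?_, ?_, ?_⟩
  · intro z
    have h1 : 0 ≤ q * max (K - P z) 0 := mul_nonneg hq0 (le_max_right _ _)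
    have h2 : max (P z - K) 0 ≤ P z := max_le (by linarith) (hP0 z)
    linarith
  · rw [Finset.sum_add_distrib, Finset.sum_sub_distrib, ← Finset.mul_sum, hP1, ← he, ← ht, hqt]
    ring
  · intro z
    show P z - max (P z - K) 0 + q * max (K - P z) 0 ≤ K
    have h1 : q * max (K - P z) 0 ≤ max (K - P z) 0 :=
      mul_le_of_le_one_left (le_max_right _ _) hq1
    rcases le_total (P z) K with h | h
    · have e1 : max (K - P z) 0 = K - P z := max_eq_left (by linarith)
      have e2 : max (P z - K) 0 = 0 := max_eq_right (by linarith)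
      rw [e1] at h1 ⊢
      rw [e2]; linarith
    · have e1 : max (K - P z) 0 = 0 := max_eq_right (by linarith)
      have e2 : max (P z - K) 0 = P z - K := max_eq_left (by linarith)
      rw [e1, e2]; linarith
  · have : ∑ z, |P z - (P z - max (P z - K) 0 + q * max (K - P z) 0)| ≤
        ∑ z, (max (P z - K) 0 + q * max (K - P z) 0) := by
      refine Finset.sum_le_sum fun z _ => ?_
      have h1 : 0 ≤ q * max (K - P z) 0 := mul_nonneg hq0 (le_max_right _ _)
      have h2 : 0 ≤ max (P z - K) 0 := le_max_right _ _
      rw [abs_le]; constructor <;> linarith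
    rw [Finset.sum_add_distrib, ← Finset.mul_sum, ← he, ← ht, hqt] at this
    linarith

/-- the sign character of F₂ -/
noncomputable def sg2 (b : ZMod 2) : ℝ := if b = 0 then 1 else -1

lemma zmod2_cases (a : ZMod 2) : a = 0 ∨ a = 1 := by revert a; decide

lemma sg2_add (a b : ZMod 2) : sg2 (a + b) = sg2 a * sg2 b := by
  have h11 : (1 + 1 : ZMod 2) = 0 := by decide
  rcases zmod2_cases a with rfl | rfl <;> rcases zmod2_cases b with rfl | rfl <;> simp [sg2, h11]

lemma sum_zmod2 (f : ZMod 2 → ℝ) : ∑ b, f b = f 0 + f 1 := Fin.sum_univ_two f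

lemma ind_eq (a b : ZMod 2) : (if a = b then (1:ℝ) else 0) = (1 + sg2 a * sg2 b) / 2 := by
  rcases zmod2_cases a with rfl | rfl <;> rcases zmod2_cases b with rfl | rfl <;> simp [sg2]

lemma abs_sg2 (b : ZMod 2) : |sg2 b| = 1 := by
  unfold sg2; split_ifs <;> simp

lemma sum_sg2 {n : ℕ} (v : Fin n → ZMod 2) (hv : v ≠ 0) :
    ∑ x : Fin n → ZMod 2, sg2 (v ⬝ᵥ x) = 0 := by
  obtain ⟨i, hi⟩ := Function.ne_iff.mp hv
  have hi1 : v i = 1 := by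
    have : ∀ b : ZMod 2, b ≠ 0 → b = 1 := by decide
    exact this _ hi
  have h := Equiv.sum_comp (Equiv.addRight (Pi.single i (1 : ZMod 2) : Fin n → ZMod 2))
    (fun x => sg2 (v ⬝ᵥ x))
  have h2 : ∀ x : Fin n → ZMod 2, sg2 (v ⬝ᵥ (Equiv.addRight (Pi.single i (1 : ZMod 2)) x))
      = - sg2 (v ⬝ᵥ x) := by
    intro x
    simp only [Equiv.coe_addRight, dotProduct_add, sg2_add, dotProduct_single, hi1]
    simp [sg2]
  simp only [h2, Finset.sum_neg_distrib] at h
  linarith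

lemma parseval2 {n : ℕ} (u : (Fin n → ZMod 2) → ℝ) :
    ∑ x : Fin n → ZMod 2, (∑ r, u r * sg2 (r ⬝ᵥ x)) ^ 2 = 2 ^ n * ∑ r, u r ^ 2 := by
  have h1 : ∀ x : Fin n → ZMod 2, (∑ r, u r * sg2 (r ⬝ᵥ x)) ^ 2 =
      ∑ r, ∑ s, u r * u s * sg2 ((r + s) ⬝ᵥ x) := by
    intro x
    rw [sq, Finset.sum_mul_sum]
    refine Finset.sum_congr rfl fun r _ => Finset.sum_congr rfl fun s _ => ?_
    rw [add_dotProduct, sg2_add]; ring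
  simp only [h1]
  rw [Finset.sum_comm, Finset.mul_sum]
  refine Finset.sum_congr rfl fun r _ => ?_
  rw [Finset.sum_comm, Finset.sum_eq_single r]
  · have : r + r = 0 := by
      ext i; simp only [Pi.add_apply, Pi.zero_apply]
      exact CharTwo.add_self_eq_zero _
    simp [this, sg2]; ring
  · intro s _ hs
    rw [← Finset.mul_sum, sum_sg2, mul_zero]
    intro h
    apply hs
    ext i
    have := congrFun h i
    have key : ∀ a b : ZMod 2, a + b = 0 → b = a := by decide
    exact key _ _ this
  · simp

lemma extractor_bound {n : ℕ} (μx : (Fin n → ZMod 2) → ℝ) (M κ ρ U0 : ℝ)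
    (hx0 : ∀ x, 0 ≤ μx x) (hx1 : ∑ x, μx x = 1) (hM : ∀ x, μx x ≤ M)
    (hρ : 0 ≤ ρ) (hU0 : 0 ≤ U0) (hκ : 0 ≤ κ)
    (hMκ : M * 2 ^ n * κ ≤ ρ ^ 2)
    (u : (Fin n → ZMod 2) → ℝ) (hu : ∀ r, 0 ≤ u r) (hus : ∑ r, u r ≤ U0)
    (huκ : ∀ r, u r ≤ κ * U0) :
    ∑ x, μx x * |∑ r, u r * sg2 (r ⬝ᵥ x)| ≤ ρ * U0 := by
  refine (abs_le_of_sq_le_sq' ?_ (mul_nonneg hρ hU0)).2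
  have hcs := Finset.sum_mul_sq_le_sq_mul_sq Finset.univ μx
    (fun x => |∑ r, u r * sg2 (r ⬝ᵥ x)|)
  simp only [sq_abs] at hcs
  rw [parseval2] at hcs
  refine hcs.trans ?_
  have h1 : ∑ x, μx x ^ 2 ≤ M := by
    calc ∑ x, μx x ^ 2 ≤ ∑ x, M * μx x := by
          refine Finset.sum_le_sum fun x _ => ?_
          rw [sq]; exact mul_le_mul_of_nonneg_right (hM x) (hx0 x)
      _ = M := by rw [← Finset.mul_sum, hx1, mul_one]
  have h2 : ∑ r, u r ^ 2 ≤ κ * U0 ^ 2 := by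
    calc ∑ r, u r ^ 2 ≤ ∑ r, (κ * U0) * u r := by
          refine Finset.sum_le_sum fun x _ => ?_
          rw [sq]; exact mul_le_mul_of_nonneg_right (huκ x) (hu x)
      _ = (κ * U0) * ∑ r, u r := by rw [← Finset.mul_sum]
      _ ≤ (κ * U0) * U0 := mul_le_mul_of_nonneg_left hus (mul_nonneg hκ hU0)
      _ = _ := by ring
  have hM0 : 0 ≤ M := (hx0 0).trans (hM 0)
  calc (∑ x, μx x ^ 2) * (2 ^ n * ∑ r, u r ^ 2) ≤ M * (2 ^ n * (κ * U0 ^ 2)) := by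
        refine mul_le_mul h1 (mul_le_mul_of_nonneg_left h2 (by positivity)) ?_ hM0
        exact mul_nonneg (by positivity) (Finset.sum_nonneg fun _ _ => sq_nonneg _)
    _ = (M * 2 ^ n * κ) * U0 ^ 2 := by ring
    _ ≤ ρ ^ 2 * U0 ^ 2 := mul_le_mul_of_nonneg_right hMκ (sq_nonneg _)
    _ = _ := by ring

lemma sum_snoc {α : Type*} [Fintype α] (k : ℕ) (f : (Fin (k+1) → α) → ℝ) :
    ∑ z, f z = ∑ z : Fin k → α, ∑ b, f (Fin.snoc (α := fun _ => α) z b) := by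
  rw [Finset.sum_comm, ← Fintype.sum_prod_type']
  exact (Equiv.sum_comp (Fin.snocEquiv (fun _ : Fin (k+1) => α)) f).symm

/-- mass of outputs -/
noncomputable def LL {n : ℕ} (U : (k : ℕ) → (Fin k → Fin n → ZMod 2) → ℝ) (k : ℕ)
    (x : Fin n → ZMod 2) (z : Fin k → ZMod 2) : ℝ :=
  ∑ a, if ∀ j, a j ⬝ᵥ x = z j then U k a else 0

lemma LL_succ {n : ℕ} (U : (k : ℕ) → (Fin k → Fin n → ZMod 2) → ℝ) (k : ℕ)
    (x : Fin n → ZMod 2) (z : Fin k → ZMod 2) (b : ZMod 2) :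
    LL U (k+1) x (Fin.snoc (α := fun _ => ZMod 2) z b) =
      ∑ a : Fin k → Fin n → ZMod 2, if ∀ j, a j ⬝ᵥ x = z j then
        ∑ r, U (k+1) (Fin.snoc (α := fun _ => Fin n → ZMod 2) a r) *
          (if r ⬝ᵥ x = b then 1 else 0) else 0 := by
  unfold LL
  rw [sum_snoc]
  refine Finset.sum_congr rfl fun a _ => ?_
  simp only [Fin.forall_fin_succ', Fin.snoc_castSucc, Fin.snoc_last]
  split_ifs with h
  · refine Finset.sum_congr rfl fun r _ => ?_
    simp [h]
  · simp [h]

lemma sum_U_le {n : ℕ} (m : ℕ) (U : (k : ℕ) → (Fin k → Fin n → ZMod 2) → ℝ)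
    (hA : ∀ k < m, ∀ a, ∑ r, U (k+1) (Fin.snoc (α := fun _ => Fin n → ZMod 2) a r) ≤ U k a)
    (k : ℕ) (hk : k ≤ m) : ∑ a, U k a ≤ U 0 Fin.elim0 := by
  induction k with
  | zero =>
    rw [Fintype.sum_unique]
    exact le_of_eq (congrArg _ (Subsingleton.elim _ _))
  | succ k ih =>
    rw [sum_snoc]
    exact (Finset.sum_le_sum fun a _ => hA k (by omega) a).trans (ih (by omega))

lemma LL_nonneg {n : ℕ} (U : (k : ℕ) → (Fin k → Fin n → ZMod 2) → ℝ)
    (hU : ∀ k a, 0 ≤ U k a) (k : ℕ) (x z) : 0 ≤ LL U k x z := by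
  unfold LL
  refine Finset.sum_nonneg fun a _ => ?_
  split_ifs
  · exact hU _ _
  · exact le_rfl

lemma phi_step {n : ℕ} (m : ℕ) (U : (k : ℕ) → (Fin k → Fin n → ZMod 2) → ℝ)
    (hU : ∀ k a, 0 ≤ U k a)
    (hA : ∀ k < m, ∀ a, ∑ r, U (k+1) (Fin.snoc (α := fun _ => Fin n → ZMod 2) a r) ≤ U k a)
    (T : ℕ → Prop) [DecidablePred T] (κ M ρ : ℝ)
    (hBd : ∀ k < m, T k → ∀ a r,
      U (k+1) (Fin.snoc (α := fun _ => Fin n → ZMod 2) a r) ≤ κ * U k a)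
    (μx : (Fin n → ZMod 2) → ℝ)
    (hx0 : ∀ x, 0 ≤ μx x) (hx1 : ∑ x, μx x = 1) (hM : ∀ x, μx x ≤ M)
    (hρ : 0 ≤ ρ) (hκ : 0 ≤ κ) (hMκ : M * 2 ^ n * κ ≤ ρ ^ 2)
    (k : ℕ) (hk : k < m) (c : ℝ) (hc : 0 ≤ c) :
    ∑ x, μx x * ∑ z, max (LL U (k+1) x z - (if T k then c / 2 else c)) 0 ≤
      ∑ x, μx x * ∑ z, max (LL U k x z - c) 0 + ρ * U 0 Fin.elim0 := by
  have hU0 := hU 0 Fin.elim0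
  have hLLs : ∀ x z, ∑ b, LL U (k+1) x (Fin.snoc (α := fun _ => ZMod 2) z b) ≤ LL U k x z := by
    intro x z
    simp only [LL_succ]
    rw [Finset.sum_comm]
    unfold LL
    refine Finset.sum_le_sum fun a _ => ?_
    split_ifs with h
    · rw [Finset.sum_comm]
      simpa using hA k hk a
    · simp
  by_cases hT : T k
  · simp only [hT, if_true]
    set h : (Fin k → Fin n → ZMod 2) → (Fin n → ZMod 2) → ℝ := fun a x =>
      |∑ r, U (k+1) (Fin.snoc (α := fun _ => Fin n → ZMod 2) a r) * sg2 (r ⬝ᵥ x)| with hh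
    have h1 : ∀ x z b, LL U (k+1) x (Fin.snoc (α := fun _ => ZMod 2) z b) ≤
        LL U k x z / 2 + (∑ a, if ∀ j, a j ⬝ᵥ x = z j then h a x else 0) / 2 := by
      intro x z b
      rw [LL_succ]
      unfold LL
      rw [← add_div, ← Finset.sum_add_distrib, Finset.sum_div]
      refine Finset.sum_le_sum fun a _ => ?_
      split_ifs with hz
      · have e1 : ∑ r, U (k+1) (Fin.snoc (α := fun _ => Fin n → ZMod 2) a r) *
          (if r ⬝ᵥ x = b then (1:ℝ) else 0) =
          ((∑ r, U (k+1) (Fin.snoc (α := fun _ => Fin n → ZMod 2) a r)) +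
          sg2 b * ∑ r, U (k+1) (Fin.snoc (α := fun _ => Fin n → ZMod 2) a r) *
            sg2 (r ⬝ᵥ x)) / 2 := by
          rw [Finset.mul_sum, ← Finset.sum_add_distrib, Finset.sum_div]
          refine Finset.sum_congr rfl fun r _ => ?_
          rw [ind_eq]; ring
        rw [e1]
        have e2 := hA k hk a
        have e3 : sg2 b * ∑ r, U (k+1) (Fin.snoc (α := fun _ => Fin n → ZMod 2) a r) *
            sg2 (r ⬝ᵥ x) ≤ h a x := by
          refine (le_abs_self _).trans ?_
          rw [abs_mul, abs_sg2, one_mul]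
        linarith
      · simp
    have h2 : ∀ x, ∑ z, max (LL U (k+1) x z - c / 2) 0 ≤
        ∑ z, max (LL U k x z - c) 0 + ∑ a, h a x := by
      intro x
      have e : ∑ a, h a x = ∑ z : Fin k → ZMod 2, ∑ a : Fin k → Fin n → ZMod 2,
          if ∀ j, a j ⬝ᵥ x = z j then h a x else 0 := by
        rw [Finset.sum_comm]
        refine Finset.sum_congr rfl fun a _ => ?_
        rw [Finset.sum_eq_single (fun j => a j ⬝ᵥ x)]
        · simp
        · intro z _ hz
          rw [if_neg]
          intro h'; exact hz (funext fun j => (h' j).symm)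
        · simp
      rw [e, sum_snoc, ← Finset.sum_add_distrib]
      refine Finset.sum_le_sum fun z _ => ?_
      have e0 : 0 ≤ ∑ a : Fin k → Fin n → ZMod 2,
          if ∀ j, a j ⬝ᵥ x = z j then h a x else 0 := by
        refine Finset.sum_nonneg fun a _ => ?_
        split_ifs
        · exact abs_nonneg _
        · exact le_rfl
      have e4 : ∀ b, max (LL U (k+1) x (Fin.snoc (α := fun _ => ZMod 2) z b) - c / 2) 0 ≤
          (max (LL U k x z - c) 0 + ∑ a : Fin k → Fin n → ZMod 2,
          if ∀ j, a j ⬝ᵥ x = z j then h a x else 0) / 2 := by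
        intro b
        have := h1 x z b
        have g1 := le_max_left (LL U k x z - c) 0
        have g2 := le_max_right (LL U k x z - c) 0
        apply max_le <;> linarith
      rw [sum_zmod2]
      have := e4 0
      have := e4 1
      linarith
    calc ∑ x, μx x * ∑ z, max (LL U (k+1) x z - c / 2) 0
        ≤ ∑ x, μx x * (∑ z, max (LL U k x z - c) 0 + ∑ a, h a x) :=
          Finset.sum_le_sum fun x _ => mul_le_mul_of_nonneg_left (h2 x) (hx0 x)
      _ = ∑ x, μx x * ∑ z, max (LL U k x z - c) 0 + ∑ a, ∑ x, μx x * h a x := by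
          simp only [mul_add, Finset.sum_add_distrib]
          congr 1
          rw [Finset.sum_comm]
          simp only [Finset.mul_sum]
      _ ≤ ∑ x, μx x * ∑ z, max (LL U k x z - c) 0 + ∑ a, ρ * U k a := by
          gcongr with a _
          exact extractor_bound μx M κ ρ (U k a) hx0 hx1 hM hρ (hU _ _) hκ hMκ _
            (fun r => hU _ _) (hA k hk a) (hBd k hk hT a)
      _ ≤ _ := by
          rw [← Finset.mul_sum]
          gcongr
          exact sum_U_le m U hA k hk.le
  · simp only [hT, if_false]
    have h2 : ∀ x, ∑ z, max (LL U (k+1) x z - c) 0 ≤ ∑ z, max (LL U k x z - c) 0 := by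
      intro x
      rw [sum_snoc]
      refine Finset.sum_le_sum fun z _ => ?_
      have := hLLs x z
      rw [sum_zmod2] at this ⊢
      have p0 := LL_nonneg U hU (k+1) x (Fin.snoc (α := fun _ => ZMod 2) z 0)
      have p1 := LL_nonneg U hU (k+1) x (Fin.snoc (α := fun _ => ZMod 2) z 1)
      have g1 := le_max_left (LL U k x z - c) 0
      have g2 := le_max_right (LL U k x z - c) 0
      rcases max_cases (LL U (k+1) x (Fin.snoc (α := fun _ => ZMod 2) z 0) - c) 0 with q | q <;>
      rcases max_cases (LL U (k+1) x (Fin.snoc (α := fun _ => ZMod 2) z 1) - c) 0 with q' | q' <;>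
      linarith [q.1, q.2, q'.1, q'.2]
    have := Finset.sum_le_sum fun x (_ : x ∈ Finset.univ) =>
      mul_le_mul_of_nonneg_left (h2 x) (hx0 x)
    have := mul_nonneg hρ hU0
    linarith

lemma phi_bound {n : ℕ} (m : ℕ) (U : (k : ℕ) → (Fin k → Fin n → ZMod 2) → ℝ)
    (hU : ∀ k a, 0 ≤ U k a)
    (hA : ∀ k < m, ∀ a, ∑ r, U (k+1) (Fin.snoc (α := fun _ => Fin n → ZMod 2) a r) ≤ U k a)
    (T : ℕ → Prop) [DecidablePred T] (κ M ρ : ℝ)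
    (hBd : ∀ k < m, T k → ∀ a r,
      U (k+1) (Fin.snoc (α := fun _ => Fin n → ZMod 2) a r) ≤ κ * U k a)
    (μx : (Fin n → ZMod 2) → ℝ)
    (hx0 : ∀ x, 0 ≤ μx x) (hx1 : ∑ x, μx x = 1) (hM : ∀ x, μx x ≤ M)
    (hρ : 0 ≤ ρ) (hκ : 0 ≤ κ) (hMκ : M * 2 ^ n * κ ≤ ρ ^ 2)
    (k : ℕ) (hk : k ≤ m) :
    ∑ x, μx x * ∑ z, max (LL U k x z -
      U 0 Fin.elim0 * ∏ j ∈ Finset.range k, (if T j then (1/2 : ℝ) else 1)) 0 ≤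
      k * (ρ * U 0 Fin.elim0) := by
  induction k with
  | zero =>
    refine le_of_eq ?_
    have : ∀ (x : Fin n → ZMod 2) z, LL U 0 x z = U 0 Fin.elim0 := by
      intro x z
      unfold LL
      rw [Fintype.sum_unique]
      simp only [IsEmpty.forall_iff, if_true]
      exact congrArg _ (Subsingleton.elim _ _)
    simp [this]
  | succ k ih =>
    have hp : 0 ≤ ∏ j ∈ Finset.range k, (if T j then (1/2 : ℝ) else 1) :=
      Finset.prod_nonneg fun j _ => by split_ifs <;> norm_num
    have := phi_step m U hU hA T κ M ρ hBd μx hx0 hx1 hM hρ hκ hMκ k (by omega)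
      (U 0 Fin.elim0 * ∏ j ∈ Finset.range k, (if T j then (1/2 : ℝ) else 1))
      (mul_nonneg (hU _ _) hp)
    have e : U 0 Fin.elim0 * ∏ j ∈ Finset.range (k+1), (if T j then (1/2 : ℝ) else 1) =
      if T k then (U 0 Fin.elim0 * ∏ j ∈ Finset.range k, (if T j then (1/2 : ℝ) else 1)) / 2
      else (U 0 Fin.elim0 * ∏ j ∈ Finset.range k, (if T j then (1/2 : ℝ) else 1)) := by
      rw [Finset.prod_range_succ]
      split_ifs <;> ring
    rw [e]
    refine this.trans ?_
    have := ih (by omega)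
    push_cast
    linarith

lemma prEvt_nonneg {m n : ℕ} (μ : Matrix (Fin m) (Fin n) (ZMod 2) → ℝ) (h0 : ∀ A, 0 ≤ μ A)
    (E) : 0 ≤ prEvt μ E := by
  unfold prEvt
  refine Finset.sum_nonneg fun a _ => ?_
  split_ifs
  · exact h0 _
  · exact le_rfl

lemma prEvt_mono {m n : ℕ} (μ : Matrix (Fin m) (Fin n) (ZMod 2) → ℝ) (h0 : ∀ A, 0 ≤ μ A)
    (E F : Matrix (Fin m) (Fin n) (ZMod 2) → Prop) (h : ∀ A, E A → F A) :
    prEvt μ E ≤ prEvt μ F := by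
  unfold prEvt
  refine Finset.sum_le_sum fun a _ => ?_
  split_ifs with h1 h2 h2
  · exact le_rfl
  · exact absurd (h a h1) h2
  · exact h0 _
  · exact le_rfl

lemma prEvt_le_of_mem {m n : ℕ} (μ : Matrix (Fin m) (Fin n) (ZMod 2) → ℝ) (h0 : ∀ A, 0 ≤ μ A)
    (E : Matrix (Fin m) (Fin n) (ZMod 2) → Prop) (A) (h : E A) : μ A ≤ prEvt μ E := by
  classical
  unfold prEvt
  have := Finset.single_le_sum (f := fun A => if E A then μ A else 0)
    (fun a _ => by split_ifs; exact h0 _; exact le_rfl) (Finset.mem_univ A)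
  simp only [h, if_true] at this
  convert this

lemma prEvt_exists {m n : ℕ} (μ : Matrix (Fin m) (Fin n) (ZMod 2) → ℝ) (h0 : ∀ A, 0 ≤ μ A)
    (E : Matrix (Fin m) (Fin n) (ZMod 2) → Prop) (h : prEvt μ E ≠ 0) : ∃ A, E A ∧ 0 < μ A := by
  by_contra hc
  push Not at hc
  apply h
  unfold prEvt
  refine Finset.sum_eq_zero fun a _ => ?_
  split_ifs with h1
  · exact le_antisymm (hc a h1) (h0 a)
  · rfl

/-- row with natural-number index -/
def rowN {m n : ℕ} (A : Matrix (Fin m) (Fin n) (ZMod 2)) (j : ℕ) : Fin n → ZMod 2 :=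
  if h : j < m then A ⟨j, h⟩ else 0

/-- the first `k` rows -/
def preN {m n : ℕ} (k : ℕ) (A : Matrix (Fin m) (Fin n) (ZMod 2)) : Fin k → Fin n → ZMod 2 :=
  fun j => rowN A j

/-- level goodness -/
def GdN {m n : ℕ} (μ : Matrix (Fin m) (Fin n) (ZMod 2) → ℝ) (δ : ℝ)
    (B : Matrix (Fin m) (Fin n) (ZMod 2) → Option (Finset (Fin m))) (S : Finset (Fin m))
    (j : ℕ) (A : Matrix (Fin m) (Fin n) (ZMod 2)) : Prop :=
  δ * prEvt μ (fun C => rowsAgree j C A) ≤ prEvt μ (fun C => B C = some S ∧ rowsAgree j C A)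

/-- good mass -/
noncomputable def UU {m n : ℕ} (μ : Matrix (Fin m) (Fin n) (ZMod 2) → ℝ) (δ : ℝ)
    (B : Matrix (Fin m) (Fin n) (ZMod 2) → Option (Finset (Fin m))) (S : Finset (Fin m))
    (k : ℕ) (a : Fin k → Fin n → ZMod 2) : ℝ :=
  prEvt μ (fun A => preN k A = a ∧ B A = some S ∧ ∀ j < k, GdN μ δ B S j A)

lemma preN_succ {m n : ℕ} (k : ℕ) (A : Matrix (Fin m) (Fin n) (ZMod 2)) (a) (r) :
    preN (k+1) A = Fin.snoc (α := fun _ => Fin n → ZMod 2) a r ↔ preN k A = a ∧ rowN A k = r := by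
  constructor
  · intro h
    constructor
    · funext j
      have := congrFun h (Fin.castSucc j)
      rw [Fin.snoc_castSucc] at this
      exact this
    · have := congrFun h (Fin.last k)
      rw [Fin.snoc_last] at this
      exact this
  · rintro ⟨rfl, rfl⟩
    funext j
    refine Fin.lastCases ?_ (fun j => ?_) j
    · rw [Fin.snoc_last]; rfl
    · rw [Fin.snoc_castSucc]; rfl

lemma rowsAgree_iff {m n : ℕ} (k : ℕ) (A C : Matrix (Fin m) (Fin n) (ZMod 2)) :
    rowsAgree k A C ↔ preN k A = preN k C := by
  constructor
  · intro h
    funext j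
    unfold preN rowN
    split_ifs with hj
    · exact h ⟨j, hj⟩ j.2
    · rfl
  · intro h j hj
    have := congrFun h ⟨j, hj⟩
    simpa [preN, rowN] using this

lemma preN_mono {m n : ℕ} {j k : ℕ} (hjk : j ≤ k) {A C : Matrix (Fin m) (Fin n) (ZMod 2)}
    (h : preN k A = preN k C) : preN j A = preN j C := by
  rw [← rowsAgree_iff] at h ⊢
  exact fun i hi => h i (by omega)

lemma GdN_congr {m n : ℕ} (μ : Matrix (Fin m) (Fin n) (ZMod 2) → ℝ) (δ : ℝ)
    (B : Matrix (Fin m) (Fin n) (ZMod 2) → Option (Finset (Fin m))) (S : Finset (Fin m))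
    (j : ℕ) {A C : Matrix (Fin m) (Fin n) (ZMod 2)} (h : preN j A = preN j C)
    (hA : GdN μ δ B S j A) : GdN μ δ B S j C := by
  unfold GdN at *
  simp only [rowsAgree_iff] at *
  rw [← h]; exact hA

lemma UU_sum {m n : ℕ} (μ : Matrix (Fin m) (Fin n) (ZMod 2) → ℝ) (h0 : ∀ A, 0 ≤ μ A) (δ : ℝ)
    (B : Matrix (Fin m) (Fin n) (ZMod 2) → Option (Finset (Fin m))) (S : Finset (Fin m))
    (k : ℕ) (a : Fin k → Fin n → ZMod 2) :
    ∑ r, UU μ δ B S (k+1) (Fin.snoc (α := fun _ => Fin n → ZMod 2) a r) ≤ UU μ δ B S k a := by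
  classical
  unfold UU prEvt
  rw [Finset.sum_comm]
  refine Finset.sum_le_sum fun A _ => ?_
  rw [Finset.sum_eq_single (rowN A k)]
  · split_ifs with h1 h2 h2
    · exact le_rfl
    · exact absurd ⟨((preN_succ _ _ _ _).1 h1.1).1, h1.2.1, fun j hj => h1.2.2 j (by omega)⟩ h2
    · exact h0 _
    · exact le_rfl
  · intro r _ hr
    rw [if_neg]
    intro h
    exact hr ((preN_succ _ _ _ _).1 h.1).2.symm
  · simp

lemma UU_bd {m n : ℕ} (μ : Matrix (Fin m) (Fin n) (ZMod 2) → ℝ) (h0 : ∀ A, 0 ≤ μ A)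
    (γ τ δ : ℝ) (hδ : 0 < δ)
    (B : Matrix (Fin m) (Fin n) (ZMod 2) → Option (Finset (Fin m)))
    (hB : IsBadSetAssignment μ τ γ B) (S : Finset (Fin m))
    (k : ℕ) (hk : k < m) (hkS : (⟨k, hk⟩ : Fin m) ∉ S) (a : Fin k → Fin n → ZMod 2) (r) :
    UU μ δ B S (k+1) (Fin.snoc (α := fun _ => Fin n → ZMod 2) a r) ≤
      ((2 : ℝ) ^ (-((1 - Real.sqrt (τ + γ)) * (n : ℝ))) / δ) * UU μ δ B S k a := by
  have hpos : 0 < (2 : ℝ) ^ (-((1 - Real.sqrt (τ + γ)) * (n : ℝ))) := Real.rpow_pos_of_pos two_pos _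
  by_cases hz : UU μ δ B S (k+1) (Fin.snoc (α := fun _ => Fin n → ZMod 2) a r) = 0
  · rw [hz]
    exact mul_nonneg (by positivity) (prEvt_nonneg μ h0 _)
  obtain ⟨A₀, ⟨hp, hBS, hG⟩, hμ⟩ := prEvt_exists μ h0 _ hz
  obtain ⟨ha, hr⟩ := (preN_succ _ _ _ _).1 hp
  have hr' : A₀ ⟨k, hk⟩ = r := by simpa [rowN, hk] using hr
  have hq : (1 - Real.sqrt (τ + γ)) * (n : ℝ) ≤ qIdx μ ⟨k, hk⟩ A₀ := by
    by_cases ht : tauRare μ τ A₀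
    · have := (hB A₀ hμ).1 ht
      rw [this] at hBS; cases hBS
    · obtain ⟨S', hS', -, h3⟩ := (hB A₀ hμ).2 ht
      rw [hBS] at hS'
      cases hS'
      exact h3 _ hkS
  have hnum : 0 < prEvt μ (fun C => C ⟨k, hk⟩ = A₀ ⟨k, hk⟩ ∧ rowsAgree k C A₀) :=
    hμ.trans_le (prEvt_le_of_mem μ h0 _ A₀ ⟨rfl, fun _ _ => rfl⟩)
  have hden : 0 < prEvt μ (fun C => rowsAgree k C A₀) :=
    hμ.trans_le (prEvt_le_of_mem μ h0 _ A₀ (fun _ _ => rfl))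
  have hpI : pIdx μ ⟨k, hk⟩ A₀ ≤ (2 : ℝ) ^ (-((1 - Real.sqrt (τ + γ)) * (n : ℝ))) := by
    have hp0 : 0 < pIdx μ ⟨k, hk⟩ A₀ := div_pos hnum hden
    rw [← Real.logb_le_iff_le_rpow one_lt_two hp0]
    unfold qIdx at hq
    linarith
  have h1 : prEvt μ (fun C => C ⟨k, hk⟩ = A₀ ⟨k, hk⟩ ∧ rowsAgree k C A₀) ≤
      (2 : ℝ) ^ (-((1 - Real.sqrt (τ + γ)) * (n : ℝ))) * prEvt μ (fun C => rowsAgree k C A₀) := by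
    unfold pIdx at hpI
    rwa [div_le_iff₀ hden] at hpI
  have h2 : δ * prEvt μ (fun C => rowsAgree k C A₀) ≤ UU μ δ B S k a := by
    refine (hG k (by omega)).trans (prEvt_mono μ h0 _ _ ?_)
    rintro C ⟨hC1, hC2⟩
    rw [rowsAgree_iff] at hC2
    refine ⟨hC2.trans ha, hC1, fun j hj => ?_⟩
    exact GdN_congr μ δ B S j (preN_mono hj.le hC2.symm) (hG j (by omega))
  have h3 : UU μ δ B S (k+1) (Fin.snoc (α := fun _ => Fin n → ZMod 2) a r) ≤
      prEvt μ (fun C => C ⟨k, hk⟩ = A₀ ⟨k, hk⟩ ∧ rowsAgree k C A₀) := by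
    refine prEvt_mono μ h0 _ _ ?_
    rintro C ⟨hC, -, -⟩
    obtain ⟨hC1, hC2⟩ := (preN_succ _ _ _ _).1 hC
    refine ⟨?_, ?_⟩
    · rw [hr', ← hC2]; simp [rowN, hk]
    · rw [rowsAgree_iff, hC1, ha]
  calc _ ≤ _ := h3
    _ ≤ _ := h1
    _ = (2 : ℝ) ^ (-((1 - Real.sqrt (τ + γ)) * (n : ℝ))) / δ *
        (δ * prEvt μ (fun C => rowsAgree k C A₀)) := by field_simp
    _ ≤ _ := by gcongr

lemma preN_full {m n : ℕ} (A : Matrix (Fin m) (Fin n) (ZMod 2)) : preN m A = A := by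
  funext j
  simp [preN, rowN]

lemma UU_full {m n : ℕ} (μ : Matrix (Fin m) (Fin n) (ZMod 2) → ℝ) (h0 : ∀ A, 0 ≤ μ A)
    (δ τ : ℝ)
    (B : Matrix (Fin m) (Fin n) (ZMod 2) → Option (Finset (Fin m)))
    (A : Matrix (Fin m) (Fin n) (ZMod 2)) (S) (hS : B A = some S)
    (hμ : 0 < μ A) (hbad : ¬ IsTauDeltaBad μ τ δ B A) : μ A ≤ UU μ δ B S m A := by
  refine prEvt_le_of_mem μ h0 _ A ⟨preN_full A, hS, fun j hj => ?_⟩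
  unfold IsTauDeltaBad at hbad
  push Not at hbad
  have h1 := hbad.2 ⟨j, hj⟩
  have hden : 0 < prEvt μ (fun C => rowsAgree j C A) :=
    hμ.trans_le (prEvt_le_of_mem μ h0 _ A (fun _ _ => rfl))
  rw [le_div_iff₀ hden, hS] at h1
  exact h1

lemma prod_half {m : ℕ} (S : Finset (Fin m)) (T : ℕ → Prop) [DecidablePred T]
    (hT : ∀ k (hk : k < m), T k ↔ (⟨k, hk⟩ : Fin m) ∉ S) :
    ∏ j ∈ Finset.range m, (if T j then (1/2 : ℝ) else 1) = (2:ℝ) ^ (-((m:ℝ) - S.card)) := by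
  rw [← Fin.prod_univ_eq_prod_range (fun j => if T j then (1/2 : ℝ) else 1) m]
  have : ∀ i : Fin m, (if T i then (1/2 : ℝ) else 1) = if i ∈ Sᶜ then (1/2 : ℝ) else 1 := by
    intro i
    simp [hT i i.2]
  simp only [this]
  rw [Finset.prod_ite_mem, Finset.univ_inter, Finset.prod_const, Finset.card_compl,
    Fintype.card_fin]
  have hc : S.card ≤ m := by simpa using Finset.card_le_univ S
  rw [← Nat.cast_sub hc, Real.rpow_neg two_pos.le, Real.rpow_natCast]
  simp

/-- per-set bound -/
lemma perS {m n : ℕ}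
    (γ τ Δ δ : ℝ) (hδ0 : 0 < δ)
    (μA : Matrix (Fin m) (Fin n) (ZMod 2) → ℝ)
    (hA0 : ∀ A, 0 ≤ μA A)
    (μx : (Fin n → ZMod 2) → ℝ)
    (hx0 : ∀ x₀, 0 ≤ μx x₀) (hx1 : ∑ x₀, μx x₀ = 1)
    (hxent : ∀ x₀ : Fin n → ZMod 2,
      μx x₀ ≤ (2 : ℝ) ^ (-((2 * Δ + Real.sqrt (τ + γ)) * (n : ℝ) + Real.logb 2 (1 / δ))))
    (B : Matrix (Fin m) (Fin n) (ZMod 2) → Option (Finset (Fin m)))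
    (hB : IsBadSetAssignment μA τ γ B) (S : Finset (Fin m)) :
    ∑ z, max (∑ x, μx x * LL (UU μA δ B S) m x z -
      prEvt μA (fun A => B A = some S) * (2 : ℝ) ^ (-((1 - Real.sqrt (τ + γ)) * (m : ℝ)))) 0 ≤
      m * (2 : ℝ) ^ (-(Δ * (n : ℝ))) * prEvt μA (fun A => B A = some S) := by
  classical
  set U := UU μA δ B S with hUdef
  have hU : ∀ k a, 0 ≤ U k a := fun k a => prEvt_nonneg _ hA0 _
  have hU0 : U 0 Fin.elim0 = prEvt μA (fun A => B A = some S) := by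
    rw [hUdef]; unfold UU
    congr 1
    funext A
    simp only [Nat.not_lt_zero, false_imp_iff, implies_true, and_true, eq_iff_iff]
    exact ⟨fun h => h.2, fun h => ⟨Subsingleton.elim _ _, h⟩⟩
  set T : ℕ → Prop := fun k => ∀ hk : k < m, (⟨k, hk⟩ : Fin m) ∉ S with hTdef
  have hT : ∀ k (hk : k < m), T k ↔ (⟨k, hk⟩ : Fin m) ∉ S :=
    fun k hk => ⟨fun h => h hk, fun h _ => h⟩
  have hMκ : (2 : ℝ) ^ (-((2 * Δ + Real.sqrt (τ + γ)) * (n : ℝ) + Real.logb 2 (1 / δ))) * 2 ^ n *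
      ((2 : ℝ) ^ (-((1 - Real.sqrt (τ + γ)) * (n : ℝ))) / δ) ≤
      ((2 : ℝ) ^ (-(Δ * (n : ℝ)))) ^ 2 := by
    refine le_of_eq ?_
    have e1 : (2:ℝ) ^ (-Real.logb 2 (1 / δ)) = δ := by
      rw [one_div, Real.logb_inv, neg_neg]
      exact Real.rpow_logb two_pos (by norm_num) hδ0
    rw [neg_add, Real.rpow_add two_pos, e1, ← Real.rpow_natCast 2 n, ← Real.rpow_natCast _ 2,
      ← Real.rpow_mul two_pos.le]
    have : ∀ a b c : ℝ, a * δ * b * (c / δ) = a * b * c := by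
      intro a b c; field_simp
    rw [this, ← Real.rpow_add two_pos, ← Real.rpow_add two_pos]
    congr 1
    push_cast
    ring
  have key := phi_bound m U hU (fun k _ a => UU_sum μA hA0 δ B S k a) T _ _
    ((2 : ℝ) ^ (-(Δ * (n : ℝ))))
    (fun k hk hTk a r => UU_bd μA hA0 γ τ δ hδ0 B hB S k hk (hTk hk) a r)
    μx hx0 hx1 hxent (by positivity) (by positivity) hMκ m le_rfl
  rw [prod_half S T hT, hU0] at key
  have hc : prEvt μA (fun A => B A = some S) * (2:ℝ) ^ (-((m:ℝ) - S.card)) ≤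
      prEvt μA (fun A => B A = some S) * (2 : ℝ) ^ (-((1 - Real.sqrt (τ + γ)) * (m : ℝ))) := by
    by_cases hz : prEvt μA (fun A => B A = some S) = 0
    · simp [hz]
    · obtain ⟨A₀, hBS, hμ⟩ := prEvt_exists μA hA0 _ hz
      have hcard : (S.card : ℝ) ≤ Real.sqrt (τ + γ) * m := by
        by_cases ht : tauRare μA τ A₀
        · have := (hB A₀ hμ).1 ht
          rw [this] at hBS; cases hBS
        · obtain ⟨S', hS', h3, -⟩ := (hB A₀ hμ).2 ht
          rw [hBS] at hS'
          cases hS'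
          exact h3
      refine mul_le_mul_of_nonneg_left ?_ (prEvt_nonneg _ hA0 _)
      refine Real.rpow_le_rpow_of_exponent_le one_le_two ?_
      linarith
  set c := prEvt μA (fun A => B A = some S) * (2:ℝ) ^ (-((m:ℝ) - S.card)) with hcdef
  calc _ ≤ ∑ z, ∑ x, μx x * max (LL U m x z - c) 0 := by
        refine Finset.sum_le_sum fun z _ => max_le ?_ ?_
        · have : ∑ x, μx x * (LL U m x z - c) ≤ ∑ x, μx x * max (LL U m x z - c) 0 :=
            Finset.sum_le_sum fun x _ => mul_le_mul_of_nonneg_left (le_max_left _ _) (hx0 x)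
          simp only [mul_sub, Finset.sum_sub_distrib, ← Finset.sum_mul, hx1, one_mul] at this
          linarith
        · exact Finset.sum_nonneg fun x _ => mul_nonneg (hx0 x) (le_max_right _ _)
    _ = ∑ x, μx x * ∑ z, max (LL U m x z - c) 0 := by
        rw [Finset.sum_comm]
        simp only [Finset.mul_sum]
    _ ≤ _ := key
    _ = _ := by ring

/-- If `x` has min-entropy at least `(2Δ + η)·n + log₂(1/δ)` and `A` has min-entropy at least
`(1-γ)·m·n`, with `A` and `x` independent, then the distribution of `A·x` is
`(ε_bad + m·2^{-Δn})`-close to a distribution on `F₂^m` with min-entropy at least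
`(1-η)·m`, where `η = √(τ+γ)` and `ε_bad` is the probability that `A` is `(τ,δ)`-bad. -/
theorem prodDist_close_to_high_min_entropy (m n : ℕ) (hm : 1 ≤ m) (hn : 1 ≤ n)
    (γ τ Δ δ : ℝ) (hγ : 0 < γ) (hτ : 0 < τ) (hΔ : 0 < Δ) (hδ0 : 0 < δ) (hδ1 : δ ≤ 1)
    (hη : Real.sqrt (τ + γ) ≤ 1)
    (μA : Matrix (Fin m) (Fin n) (ZMod 2) → ℝ)
    (hA0 : ∀ A, 0 ≤ μA A) (hA1 : ∑ A, μA A = 1)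
    (μx : (Fin n → ZMod 2) → ℝ)
    (hx0 : ∀ x₀, 0 ≤ μx x₀) (hx1 : ∑ x₀, μx x₀ = 1)
    (hxent : ∀ x₀ : Fin n → ZMod 2,
      μx x₀ ≤ (2 : ℝ) ^ (-((2 * Δ + Real.sqrt (τ + γ)) * (n : ℝ) + Real.logb 2 (1 / δ))))
    (hAent : ∀ A₀, μA A₀ ≤ (2 : ℝ) ^ (-((1 - γ) * (m : ℝ) * (n : ℝ))))
    (B : Matrix (Fin m) (Fin n) (ZMod 2) → Option (Finset (Fin m)))
    (hB : IsBadSetAssignment μA τ γ B) :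
    ∃ ν : (Fin m → ZMod 2) → ℝ,
      (∀ z, 0 ≤ ν z) ∧ (∑ z, ν z = 1) ∧
      (∀ z, ν z ≤ (2 : ℝ) ^ (-((1 - Real.sqrt (τ + γ)) * (m : ℝ)))) ∧
      (1 / 2) * ∑ z, |prodDist μA μx z - ν z|
        ≤ prEvt μA (IsTauDeltaBad μA τ δ B) + (m : ℝ) * (2 : ℝ) ^ (-(Δ * (n : ℝ))) := by
  classical
  set η := Real.sqrt (τ + γ) with hηdef
  set K := (2 : ℝ) ^ (-((1 - η) * (m : ℝ))) with hKdef
  have hη0 : 0 ≤ η := Real.sqrt_nonneg _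
  have hK0 : 0 < K := Real.rpow_pos_of_pos two_pos _
  have hswap : ∀ f : Matrix (Fin m) (Fin n) (ZMod 2) → ℝ,
      ∑ z : Fin m → ZMod 2, ∑ A, ∑ x₀, (if A.mulVec x₀ = z then f A * μx x₀ else 0) = ∑ A, f A := by
    intro f
    rw [Finset.sum_comm]
    refine Finset.sum_congr rfl fun A _ => ?_
    rw [Finset.sum_comm]
    simp [← Finset.mul_sum, hx1]
  set fb : Matrix (Fin m) (Fin n) (ZMod 2) → ℝ := fun A =>
    if IsTauDeltaBad μA τ δ B A then μA A else 0 with hfb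
  set Pb : (Fin m → ZMod 2) → ℝ := fun z =>
    ∑ A, ∑ x₀, (if A.mulVec x₀ = z then fb A * μx x₀ else 0) with hPb
  have hPb0 : ∀ z, 0 ≤ Pb z := by
    intro z
    refine Finset.sum_nonneg fun A _ => Finset.sum_nonneg fun x _ => ?_
    split_ifs
    · refine mul_nonneg ?_ (hx0 x)
      simp only [hfb]
      split_ifs
      · exact hA0 _
      · exact le_rfl
    · exact le_rfl
  have hPbs : ∑ z, Pb z = prEvt μA (IsTauDeltaBad μA τ δ B) := by
    rw [hPb, hswap]
    unfold prEvt
    exact Finset.sum_congr rfl fun A _ => by simp only [hfb]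
  set w : Finset (Fin m) → ℝ := fun S => prEvt μA (fun A => B A = some S) with hw
  have hw0 : ∀ S, 0 ≤ w S := fun S => prEvt_nonneg _ hA0 _
  have hws : ∑ S, w S ≤ 1 := by
    rw [← hA1]
    simp only [hw]
    unfold prEvt
    rw [Finset.sum_comm]
    refine Finset.sum_le_sum fun A _ => ?_
    cases hBA : B A with
    | none => simpa [hBA] using hA0 A
    | some S => simp [hBA]
  have hdec : ∀ z, prodDist μA μx z ≤
      Pb z + ∑ S, ∑ x, μx x * LL (UU μA δ B S) m x z := by
    intro z
    have e1 : ∑ S, ∑ x, μx x * LL (UU μA δ B S) m x z =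
        ∑ A : Matrix (Fin m) (Fin n) (ZMod 2), ∑ x₀, if A.mulVec x₀ = z then
          (∑ S, UU μA δ B S m A) * μx x₀ else 0 := by
      unfold LL
      simp only [Finset.mul_sum]
      rw [Finset.sum_comm]
      rw [Finset.sum_comm (s := (Finset.univ : Finset (Matrix (Fin m) (Fin n) (ZMod 2))))]
      refine Finset.sum_congr rfl fun x _ => ?_
      rw [Finset.sum_comm]
      refine Finset.sum_congr rfl fun A _ => ?_
      have : (Matrix.mulVec A x = z) ↔ ∀ j, A j ⬝ᵥ x = z j := funext_iff
      by_cases h : ∀ j, A j ⬝ᵥ x = z j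
      · simp only [this, h, implies_true, if_true, Finset.sum_mul]
        exact Finset.sum_congr rfl fun S _ => mul_comm _ _
      · simp only [this, h, if_false, mul_zero, Finset.sum_const_zero]
    rw [e1]
    simp only [hPb]
    rw [← Finset.sum_add_distrib]
    unfold prodDist
    refine Finset.sum_le_sum fun A _ => ?_
    rw [← Finset.sum_add_distrib]
    refine Finset.sum_le_sum fun x _ => ?_
    have hmain : μA A ≤ fb A + ∑ S, UU μA δ B S m A := by
      have hs0 : ∀ S, 0 ≤ UU μA δ B S m A := fun S => prEvt_nonneg _ hA0 _
      have hs : 0 ≤ ∑ S, UU μA δ B S m A := Finset.sum_nonneg fun S _ => hs0 S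
      by_cases hbad : IsTauDeltaBad μA τ δ B A
      · simp only [hfb, hbad, if_true]; linarith
      · simp only [hfb, hbad, if_false, zero_add]
        rcases eq_or_lt_of_le (hA0 A) with h | h
        · rw [← h]; exact hs
        · obtain ⟨S, hS, -, -⟩ := (hB A h).2 (fun ht => hbad (Or.inl ht))
          exact (UU_full μA hA0 δ τ B A S hS h hbad).trans
            (Finset.single_le_sum (fun S _ => hs0 S) (Finset.mem_univ S))
    split_ifs
    · rw [← add_mul]
      exact mul_le_mul_of_nonneg_right hmain (hx0 x)
    · simp
  apply close_of_excess (prodDist μA μx) K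
  · intro z
    unfold prodDist
    refine Finset.sum_nonneg fun A _ => Finset.sum_nonneg fun x _ => ?_
    split_ifs
    · exact mul_nonneg (hA0 A) (hx0 x)
    · exact le_rfl
  · rw [← hA1, ← hswap μA]
    unfold prodDist
    refine Finset.sum_congr rfl fun z _ => Finset.sum_congr rfl fun A _ =>
      Finset.sum_congr rfl fun x _ => ?_
    congr
  · exact hK0.le
  · have : (Fintype.card (Fin m → ZMod 2) : ℝ) = (2:ℝ) ^ (m:ℝ) := by
      simp [ZMod.card]
    rw [this, hKdef, ← Real.rpow_add two_pos]
    apply Real.one_le_rpow one_le_two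
    have : 0 ≤ η * m := by positivity
    linarith
  · calc ∑ z, max (prodDist μA μx z - K) 0
        ≤ ∑ z, (Pb z + ∑ S, max (∑ x, μx x * LL (UU μA δ B S) m x z - w S * K) 0) := by
          refine Finset.sum_le_sum fun z _ => ?_
          have h1 : ∑ S, (∑ x, μx x * LL (UU μA δ B S) m x z - w S * K) ≤
            ∑ S, max (∑ x, μx x * LL (UU μA δ B S) m x z - w S * K) 0 :=
            Finset.sum_le_sum fun S _ => le_max_left _ _
          have h2 : 0 ≤ ∑ S, max (∑ x, μx x * LL (UU μA δ B S) m x z - w S * K) 0 :=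
            Finset.sum_nonneg fun S _ => le_max_right _ _
          rw [Finset.sum_sub_distrib, ← Finset.sum_mul] at h1
          have h3 : (∑ S, w S) * K ≤ 1 * K := mul_le_mul_of_nonneg_right hws hK0.le
          have h4 := hdec z
          have h5 := hPb0 z
          apply max_le <;> linarith
      _ = prEvt μA (IsTauDeltaBad μA τ δ B) +
          ∑ S, ∑ z, max (∑ x, μx x * LL (UU μA δ B S) m x z - w S * K) 0 := by
          rw [Finset.sum_add_distrib, hPbs, Finset.sum_comm]
      _ ≤ prEvt μA (IsTauDeltaBad μA τ δ B) +
          ∑ S, m * (2 : ℝ) ^ (-(Δ * (n : ℝ))) * w S := by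
          gcongr with S _
          exact perS γ τ Δ δ hδ0 μA hA0 μx hx0 hx1 hxent B hB S
      _ ≤ _ := by
          rw [← Finset.mul_sum]
          have : 0 ≤ (m:ℝ) * (2 : ℝ) ^ (-(Δ * (n : ℝ))) := by positivity
          have := mul_le_mul_of_nonneg_left hws this
          linarith
end
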